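/- arXiv:2001.11407 — 2 statements merged into one kernel-verified Lean document; each statement's English description precedes it below -/
import Mathlib

section
/- The unique cubic-triangular number is 1: if n and m are positive integers with n(n+1)/2 = m^3, then n = 1 and m = 1. -/
theorem ct_step (p q s u v : ℤ) (hs : 0 < s) (hsuv : s = u ^ 2 + 3 * v ^ 2)
    (h1 : s ∣ q * u - p * v) (h2 : s ∣ p ^ 2 + 3 * q ^ 2) :
    ∃ p' q' : ℤ, p = u * p' - 3 * v * q' ∧ q = u * q' + v * p' ∧
      p ^ 2 + 3 * q ^ 2 = s * (p' ^ 2 + 3 * q' ^ 2) := by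
  have h3 : s ∣ p * u + 3 * q * v := by
    have : s ^ 2 ∣ (p * u + 3 * q * v) ^ 2 := by
      obtain ⟨a, ha⟩ := h1
      obtain ⟨b, hb⟩ := h2
      refine ⟨b - 3 * a ^ 2, ?_⟩
      have : (p * u + 3 * q * v) ^ 2
          = (u ^ 2 + 3 * v ^ 2) * (p ^ 2 + 3 * q ^ 2) - 3 * (q * u - p * v) ^ 2 := by ring
      rw [this, ha, hb, ← hsuv]; ring
    exact (Int.pow_dvd_pow_iff (by norm_num)).1 this
  obtain ⟨q', hq'⟩ := h1
  obtain ⟨p', hp'⟩ := h3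
  have e1 : p = u * p' - 3 * v * q' := by
    apply mul_left_cancel₀ hs.ne'
    linear_combination u * hp' - 3 * v * hq' + p * hsuv
  have e2 : q = u * q' + v * p' := by
    apply mul_left_cancel₀ hs.ne'
    linear_combination u * hq' + v * hp' + q * hsuv
  refine ⟨p', q', e1, e2, ?_⟩
  rw [hsuv, e1, e2]; ring

theorem ct_next (q s u v p' q' : ℤ) (hsuv : s = u ^ 2 + 3 * v ^ 2)
    (hq : q = u * q' + v * p') (hc : IsCoprime s q) (h : s ∣ p' ^ 2 + 3 * q' ^ 2) :
    s ∣ q' * u - p' * v := by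
  apply hc.dvd_of_dvd_mul_right
  obtain ⟨k, hk⟩ := h
  refine ⟨q' ^ 2 - v ^ 2 * k, ?_⟩
  rw [hq]
  linear_combination (-v ^ 2) * hk - q' ^ 2 * hsuv

theorem ct_coprime_norm (p q s : ℤ) (hc : IsCoprime p q) (h : s ∣ p ^ 2 + 3 * q ^ 2) :
    IsCoprime s q := by
  refine IsCoprime.of_isCoprime_of_dvd_left ?_ h
  have : IsCoprime (p ^ 2) q := hc.pow_left
  have := this.add_mul_left_left (3 * q)
  exact (by ring_nf at this ⊢; exact this)

theorem ct_thue (p q s : ℤ) (hs : 0 < s) :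
    ∃ x y : ℤ, (x ≠ 0 ∨ y ≠ 0) ∧ s ∣ q * x - p * y ∧ x ^ 2 + 3 * y ^ 2 < 4 * s := by
  obtain ⟨n, rfl⟩ := Int.eq_ofNat_of_zero_le hs.le
  have hn : 0 < n := by exact_mod_cast hs
  have : NeZero n := ⟨hn.ne'⟩
  set f := Nat.sqrt n with hf
  set c := Nat.sqrt (n - 1) with hcdef
  have f1 : f * f ≤ n := Nat.sqrt_le n
  have f2 : n < (f + 1) * (f + 1) := Nat.lt_succ_sqrt n
  have c1 : c * c ≤ n - 1 := Nat.sqrt_le (n - 1)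
  have c2 : n - 1 < (c + 1) * (c + 1) := Nat.lt_succ_sqrt (n - 1)
  have hcard : n < (f + 1) * (c + 1) := by
    rcases le_or_gt (c + 1) f with h | h
    · have : n ≤ (c + 1) * (c + 1) := by omega
      nlinarith
    · nlinarith
  obtain ⟨a, ha, b, hb, hab, heq⟩ := Finset.exists_ne_map_eq_of_card_lt_of_maps_to
    (s := Finset.range (f + 1) ×ˢ Finset.range (c + 1)) (t := (Finset.univ : Finset (ZMod n)))
    (f := fun a => (q : ZMod n) * (a.1 : ZMod n) - (p : ZMod n) * (a.2 : ZMod n))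
    (by simpa [ZMod.card] using hcard) (by intro _ _; simp)
  obtain ⟨a1, a2⟩ := a
  obtain ⟨b1, b2⟩ := b
  simp only [Finset.mem_product, Finset.mem_range] at ha hb heq
  refine ⟨(a1 : ℤ) - b1, (a2 : ℤ) - b2, ?_, ?_, ?_⟩
  · by_contra! hh
    apply hab
    ext <;> simp <;> omega
  · rw [← ZMod.intCast_zmod_eq_zero_iff_dvd]
    push_cast
    linear_combination heq
  · have k1 : |(a1 : ℤ) - b1| ≤ f := by rw [abs_le]; omega
    have k2 : |(a2 : ℤ) - b2| ≤ c := by rw [abs_le]; omega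
    have l1 := sq_le_sq' (abs_le.1 k1).1 (abs_le.1 k1).2
    have l2 := sq_le_sq' (abs_le.1 k2).1 (abs_le.1 k2).2
    have f1' : (f : ℤ) * f ≤ n := by exact_mod_cast f1
    have c1' : (c : ℤ) * c < n := by
      have : c * c < n := by omega
      exact_mod_cast this
    nlinarith

theorem ct_rep (p q s : ℤ) (hs : 0 < s) (hodd : s % 2 = 1) (h3 : ¬ (3 : ℤ) ∣ s)
    (hc : IsCoprime p q) (h : s ∣ p ^ 2 + 3 * q ^ 2) :
    ∃ u v : ℤ, s = u ^ 2 + 3 * v ^ 2 ∧ s ∣ q * u - p * v := by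
  obtain ⟨x, y, hne, hd, hlt⟩ := ct_thue p q s hs
  have hcq := ct_coprime_norm p q s hc h
  have hd2 : s ∣ x ^ 2 + 3 * y ^ 2 := by
    have : s ∣ q ^ 2 * (x ^ 2 + 3 * y ^ 2) := by
      obtain ⟨a, ha⟩ := hd
      obtain ⟨b, hb⟩ := h
      refine ⟨a * (q * x + p * y) + y ^ 2 * b, ?_⟩
      linear_combination (q * x + p * y) * ha + y ^ 2 * hb
    exact (hcq.pow_right (n := 2)).dvd_of_dvd_mul_left this
  obtain ⟨k, hk⟩ := hd2
  have hpos : 0 < x ^ 2 + 3 * y ^ 2 := by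
    rcases hne with h | h <;> positivity
  have hk1 : 0 < k := by
    by_contra hh
    nlinarith
  have hk2 : k < 4 := by
    by_contra hh
    nlinarith
  interval_cases k
  · exact ⟨x, y, by linarith, hd⟩
  · exfalso
    obtain ⟨t, ht⟩ : ∃ t, s = 2 * t + 1 := ⟨s / 2, by omega⟩
    have h4 : (x ^ 2 + 3 * y ^ 2) % 4 = 2 := by omega
    have hx : x % 4 = 0 ∨ x % 4 = 1 ∨ x % 4 = 2 ∨ x % 4 = 3 := by omega
    have hy : y % 4 = 0 ∨ y % 4 = 1 ∨ y % 4 = 2 ∨ y % 4 = 3 := by omega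
    rcases hx with hx | hx | hx | hx <;> rcases hy with hy | hy | hy | hy <;>
      simp [pow_two, Int.add_emod, Int.mul_emod, hx, hy] at h4
  · have hx3 : (3 : ℤ) ∣ x := by
      have : (3 : ℤ) ∣ x ^ 2 := ⟨s - y ^ 2, by linarith⟩
      exact Int.prime_three.dvd_of_dvd_pow this
    obtain ⟨w, rfl⟩ := hx3
    refine ⟨y, -w, by nlinarith, ?_⟩
    have hs3 : IsCoprime s 3 := ((Int.prime_three.coprime_iff_not_dvd).2 h3).symm
    apply hs3.dvd_of_dvd_mul_left
    apply hcq.dvd_of_dvd_mul_left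
    obtain ⟨a, ha⟩ := hd
    obtain ⟨b, hb⟩ := h
    refine ⟨p * a + y * b, ?_⟩
    linear_combination p * ha + y * hb

theorem ct_cube (p q s : ℤ) (hodd : s % 2 = 1) (h3 : ¬ (3 : ℤ) ∣ p)
    (hc : IsCoprime p q) (h : p ^ 2 + 3 * q ^ 2 = s ^ 3) :
    ∃ u v : ℤ, s = u ^ 2 + 3 * v ^ 2 ∧ p = u * (u ^ 2 - 9 * v ^ 2) ∧
      q = 3 * v * (u ^ 2 - v ^ 2) := by
  have hs : 0 < s := by
    have : 0 ≤ s ^ 3 := by rw [← h]; positivity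
    have := (Odd.pow_nonneg_iff (by decide : Odd 3)).1 this
    omega
  have h3s : ¬ (3 : ℤ) ∣ s := by
    rintro ⟨t, rfl⟩
    apply h3
    have : (3 : ℤ) ∣ p ^ 2 := ⟨9 * t ^ 3 - q ^ 2, by linear_combination h⟩
    exact Int.prime_three.dvd_of_dvd_pow this
  have hd : s ∣ p ^ 2 + 3 * q ^ 2 := ⟨s ^ 2, by rw [h]; ring⟩
  obtain ⟨u, v, hsuv, hdiv⟩ := ct_rep p q s hs hodd h3s hc hd
  obtain ⟨p1, q1, hp, hq, hn⟩ := ct_step p q s u v hs hsuv hdiv hd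
  have hn1 : p1 ^ 2 + 3 * q1 ^ 2 = s ^ 2 := by
    apply mul_left_cancel₀ hs.ne'
    rw [← hn, h]; ring
  have hd1 : s ∣ p1 ^ 2 + 3 * q1 ^ 2 := ⟨s, by rw [hn1]; ring⟩
  have hc1 : IsCoprime p1 q1 := by
    obtain ⟨a, b, hab⟩ := hc
    refine ⟨a * u + b * v, b * u - 3 * a * v, ?_⟩
    rw [← hab, hp, hq]; ring
  have hdiv1 := ct_next q s u v p1 q1 hsuv hq (ct_coprime_norm p q s hc hd) hd1
  obtain ⟨p2, q2, hp1, hq1, hn'⟩ := ct_step p1 q1 s u v hs hsuv hdiv1 hd1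
  have hn2 : p2 ^ 2 + 3 * q2 ^ 2 = s := by
    apply mul_left_cancel₀ hs.ne'
    rw [← hn', hn1]; ring
  have hd2 : s ∣ p2 ^ 2 + 3 * q2 ^ 2 := by rw [hn2]
  have hdiv2 := ct_next q1 s u v p2 q2 hsuv hq1 (ct_coprime_norm p1 q1 s hc1 hd1) hd2
  obtain ⟨p3, q3, hp2, hq2, hn''⟩ := ct_step p2 q2 s u v hs hsuv hdiv2 hd2
  have hn3 : p3 ^ 2 + 3 * q3 ^ 2 = 1 := by
    apply mul_left_cancel₀ hs.ne'
    rw [← hn'', hn2]; ring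
  have hq3 : q3 = 0 := by
    by_contra hne
    have : 0 < q3 ^ 2 := by positivity
    nlinarith [sq_nonneg p3]
  subst hq3
  have hp3 : p3 = 1 ∨ p3 = -1 := by
    have : (p3 - 1) * (p3 + 1) = 0 := by linarith
    rcases mul_eq_zero.1 this with h | h
    · left; linarith
    · right; linarith
  rcases hp3 with rfl | rfl
  · refine ⟨u, v, hsuv, ?_, ?_⟩
    · rw [hp, hp1, hq1, hp2, hq2]; ring
    · rw [hq, hp1, hq1, hp2, hq2]; ring
  · refine ⟨-u, -v, by rw [hsuv]; ring, ?_, ?_⟩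
    · rw [hp, hp1, hq1, hp2, hq2]; ring
    · rw [hq, hp1, hq1, hp2, hq2]; ring

/-- Two coprime integers whose product is a cube are cubes. -/
theorem ct_split (a b c : ℤ) (hc : IsCoprime a b) (h : a * b = c ^ 3) :
    ∃ d e : ℤ, a = d ^ 3 ∧ b = e ^ 3 := by
  obtain ⟨d, hd⟩ := Int.eq_pow_of_mul_eq_pow_odd_left hc (by decide : Odd 3) h
  obtain ⟨e, he⟩ := Int.eq_pow_of_mul_eq_pow_odd_right hc (by decide : Odd 3) h
  exact ⟨d, e, hd, he⟩

theorem ct_abs_lt (c z k : ℤ) (hc : c ≠ 0) (hk : 1 < |k|) (h : z ^ 3 = c ^ 3 * k) :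
    c.natAbs < z.natAbs := by
  have h1 : |z| ^ 3 = |c| ^ 3 * |k| := by rw [← abs_pow, h, abs_mul, abs_pow]
  have h2 : 0 < |c| := abs_pos.2 hc
  have h3 : |c| ^ 3 < |z| ^ 3 := by
    rw [h1]
    have : 0 < |c| ^ 3 := by positivity
    nlinarith
  have h4 := lt_of_pow_lt_pow_left₀ 3 (abs_nonneg z) h3
  rw [Int.abs_eq_natAbs, Int.abs_eq_natAbs] at h4
  exact_mod_cast h4

/-- Coprimality of `a - b` and `a + b` for coprime `a`, `b` with odd sum. -/
theorem ct_coprime_sub_add (a b : ℤ) (hc : IsCoprime a b) (ho : (a + b) % 2 = 1) :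
    IsCoprime (a - b) (a + b) := by
  have h2 : IsCoprime (a + b) 2 := by
    refine ⟨1, -((a + b) / 2), ?_⟩
    omega
  have h1 : IsCoprime (a + b) a := by
    have := hc.symm.add_mul_left_left 1
    exact (by ring_nf at this ⊢; exact this)
  have h3 : IsCoprime (a + b) (2 * a) := h2.mul_right h1
  have := h3.add_mul_left_right (-1)
  have h4 : 2 * a + (a + b) * (-1) = a - b := by ring
  rw [h4] at this
  exact this.symm

theorem ct_main (N : ℕ) : ∀ x y z : ℤ, z.natAbs = N → IsCoprime x y →
    x ^ 3 + y ^ 3 = 2 * z ^ 3 → z ≠ 0 → x = y := by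
  induction N using Nat.strong_induction_on with
  | _ N ih =>
  intro x y z hN hc h hz
  have hxy : (x + y) % 2 = 0 := by
    have e : (x ^ 3 + y ^ 3) % 2 = 0 := by omega
    rcases Int.emod_two_eq_zero_or_one x with hx | hx <;>
    rcases Int.emod_two_eq_zero_or_one y with hy | hy <;>
    simp [pow_succ, Int.add_emod, Int.mul_emod, hx, hy] at e ⊢
  obtain ⟨p, hp⟩ : ∃ p, x + y = 2 * p := ⟨(x + y) / 2, by omega⟩
  obtain ⟨q, rfl⟩ : ∃ q, x = p + q := ⟨x - p, by ring⟩
  obtain rfl : y = p - q := by linarith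
  by_contra hne
  have hq0 : q ≠ 0 := by
    rintro rfl
    simp at hne
  have hpq : IsCoprime p q := by
    obtain ⟨a, b, hab⟩ := hc
    exact ⟨a + b, a - b, by rw [← hab]; ring⟩
  have hodd : (p + q) % 2 = 1 := by
    by_contra hh
    obtain ⟨a, b, hab⟩ := hc
    have h1 : (2 : ℤ) ∣ p + q := by omega
    have h2 : (2 : ℤ) ∣ p - q := by omega
    have : (2 : ℤ) ∣ 1 := by
      rw [← hab]; exact dvd_add (h1.mul_left _) (h2.mul_left _)
    omega
  have hz3 : p * (p ^ 2 + 3 * q ^ 2) = z ^ 3 := by linarith [h, hp]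
  have hp0 : p ≠ 0 := by
    rintro rfl
    apply hz
    have : z ^ 3 = 0 := by rw [← hz3]; ring
    exact pow_eq_zero_iff (by norm_num) |>.1 this
  have hnodd : ∀ a b s : ℤ, (a + b) % 2 = 1 → a ^ 2 + 3 * b ^ 2 = s ^ 3 → s % 2 = 1 := by
    intro a b s hab hs
    have e : (a ^ 2 + 3 * b ^ 2) % 2 = s ^ 3 % 2 := by rw [hs]
    rcases Int.emod_two_eq_zero_or_one a with hx | hx <;>
    rcases Int.emod_two_eq_zero_or_one b with hy | hy <;>
    rcases Int.emod_two_eq_zero_or_one s with hs | hs <;>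
    first
    | exact hs
    | (simp [pow_succ, Int.add_emod, Int.mul_emod, hx, hy, hs] at e; done)
    | omega
  by_cases h3 : (3 : ℤ) ∣ p
  · obtain ⟨P, rfl⟩ := h3
    have hP0 : P ≠ 0 := by rintro rfl; simp at hp0
    have h3q : IsCoprime (3 : ℤ) q := hpq.of_isCoprime_of_dvd_left ⟨P, rfl⟩
    have hPq : IsCoprime P q := hpq.of_isCoprime_of_dvd_left ⟨3, by ring⟩
    have hcop : IsCoprime (9 * P) (q ^ 2 + 3 * P ^ 2) := by
      have a1 : IsCoprime (3 : ℤ) (q ^ 2 + 3 * P ^ 2) :=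
        (h3q.pow_right (n := 2)).add_mul_left_right (P ^ 2)
      have a2 : IsCoprime P (q ^ 2 + 3 * P ^ 2) := by
        have := (hPq.pow_right (n := 2)).add_mul_left_right (3 * P)
        exact (by ring_nf at this ⊢; exact this)
      have := (a1.mul_left a1).mul_left a2
      norm_num at this; exact this
    obtain ⟨r, s, hr, hs⟩ := ct_split _ _ z hcop (by rw [← hz3]; ring)
    have hso : s % 2 = 1 := hnodd q P s (by omega) hs
    have hq3 : ¬ (3 : ℤ) ∣ q := (Int.prime_three.coprime_iff_not_dvd).1 h3q
    obtain ⟨u, v, hsuv, hu, hv⟩ := ct_cube q P s hso hq3 hPq.symm hs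
    have huv : IsCoprime u v :=
      (hPq.symm.of_isCoprime_of_dvd_left ⟨_, hu⟩).of_isCoprime_of_dvd_right
        ⟨3 * (u ^ 2 - v ^ 2), by rw [hv]; ring⟩
    have hr3 : (3 : ℤ) ∣ r := by
      have : (3 : ℤ) ∣ r ^ 3 := ⟨3 * P, by rw [← hr]; ring⟩
      exact Int.prime_three.dvd_of_dvd_pow this
    obtain ⟨r', rfl⟩ := hr3
    have hprod : v * ((u - v) * (u + v)) = r' ^ 3 := by
      rw [hv] at hr
      linarith
    have huvo : (u + v) % 2 = 1 := by
      by_contra hh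
      have : (u ^ 2 + 3 * v ^ 2) % 2 = 0 := by
        obtain ⟨t, ht⟩ : ∃ t, u = 2 * t - v := ⟨(u + v) / 2, by omega⟩
        have : u ^ 2 + 3 * v ^ 2 = 2 * (2 * t ^ 2 - 2 * t * v + 2 * v ^ 2) := by rw [ht]; ring
        omega
      omega
    have b1 : IsCoprime v ((u - v) * (u + v)) := by
      have := (huv.symm.pow_right (n := 2)).add_mul_left_right (-v)
      exact (by ring_nf at this ⊢; exact this)
    obtain ⟨a, d, ha, hd⟩ := ct_split _ _ _ b1 hprod
    have b2 := ct_coprime_sub_add u v huv huvo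
    obtain ⟨b, c, hb, hcc⟩ := ct_split _ _ _ b2 hd
    have hv0 : v ≠ 0 := by rintro rfl; simp at hv; exact hP0 hv
    have ha0 : a ≠ 0 := by rintro rfl; simp at ha; exact hv0 ha
    have hcb : IsCoprime c (-b) := by
      rw [hb, hcc] at b2
      exact ((IsCoprime.pow_iff (by norm_num) (by norm_num)).1 b2).symm.neg_right
    have hlt : a.natAbs < z.natAbs := by
      apply ct_abs_lt a z (27 * (u ^ 2 - v ^ 2) * s ^ 3) ha0
      · have : (u ^ 2 - v ^ 2) * s ^ 3 ≠ 0 := by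
          apply mul_ne_zero
          · intro h0; rw [h0] at hv; simp at hv; exact hP0 hv
          · apply pow_ne_zero; omega
        rw [mul_assoc, abs_mul]
        have := Int.one_le_abs this
        have e27 : |(27 : ℤ)| = 27 := by norm_num
        rw [e27]
        linarith
      · rw [← ha, ← hz3, ← hs, hv]; ring
    have := ih _ (hN ▸ hlt) c (-b) a rfl hcb (by linear_combination -hcc + hb + 2 * ha) ha0
    have : u = 0 := by
      have : u + v = -(u - v) := by rw [hb, hcc, this]; ring
      linarith
    apply hq0; rw [hu, this]; ring
  · have h3p : IsCoprime (3 : ℤ) p := (Int.prime_three.coprime_iff_not_dvd).2 h3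
    have hcop : IsCoprime p (p ^ 2 + 3 * q ^ 2) := by
      have := (h3p.symm.mul_right (hpq.pow_right (n := 2))).add_mul_left_right p
      exact (by ring_nf at this ⊢; exact this)
    obtain ⟨r, s, hr, hs⟩ := ct_split _ _ z hcop hz3
    have hso : s % 2 = 1 := hnodd p q s hodd hs
    obtain ⟨u, v, hsuv, hu, hv⟩ := ct_cube p q s hso h3 hpq hs
    have hup : IsCoprime u (3 * v) :=
        IsCoprime.mul_right (h3p.of_isCoprime_of_dvd_right ⟨_, hu⟩).symm
          ((hpq.of_isCoprime_of_dvd_left ⟨_, hu⟩).of_isCoprime_of_dvd_right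
            ⟨3 * (u ^ 2 - v ^ 2), by rw [hv]; ring⟩)
    have huvo : (u + 3 * v) % 2 = 1 := by
      by_contra hh
      have : (u ^ 2 + 3 * v ^ 2) % 2 = 0 := by
        obtain ⟨t, ht⟩ : ∃ t, u = 2 * t - v := ⟨(u + v) / 2, by omega⟩
        have : u ^ 2 + 3 * v ^ 2 = 2 * (2 * t ^ 2 - 2 * t * v + 2 * v ^ 2) := by rw [ht]; ring
        omega
      omega
    have b1 : IsCoprime u ((u - 3 * v) * (u + 3 * v)) := by
      have := ((hup.pow_right (n := 2)).neg_right).add_mul_left_right u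
      exact (by ring_nf at this ⊢; exact this)
    obtain ⟨c, d, hcc, hd⟩ := ct_split _ _ r b1 (by rw [← hr, hu]; ring)
    have b2 := ct_coprime_sub_add u (3 * v) hup huvo
    obtain ⟨a, b, ha, hb⟩ := ct_split _ _ _ b2 hd
    have hv0 : v ≠ 0 := by rintro rfl; simp at hv; exact hq0 hv
    have hu0 : u ≠ 0 := by rintro rfl; simp at hu; exact hp0 hu
    have hc0 : c ≠ 0 := by rintro rfl; simp at hcc; exact hu0 hcc
    have hab : IsCoprime a b := by
      rw [ha, hb] at b2
      exact (IsCoprime.pow_iff (by norm_num) (by norm_num)).1 b2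
    have hlt : c.natAbs < z.natAbs := by
      apply ct_abs_lt c z ((u ^ 2 - 9 * v ^ 2) * s ^ 3) hc0
      · have h0 : (u ^ 2 - 9 * v ^ 2) ≠ 0 := by
          intro h0; rw [h0] at hu; simp at hu; exact hp0 hu
        have h1 := Int.one_le_abs h0
        have h2 : 3 ≤ s := by
          have : 0 < v ^ 2 := by positivity
          nlinarith [sq_nonneg u]
        have h4 : 3 ^ 3 ≤ s ^ 3 := pow_le_pow_left₀ (by norm_num) h2 3
        have h5 : 3 ^ 3 ≤ |s ^ 3| := h4.trans (le_abs_self _)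
        rw [abs_mul]
        nlinarith
      · rw [← hcc, ← hz3, ← hs]
        nth_rewrite 1 [hu]; ring
    have := ih _ (hN ▸ hlt) a b c rfl hab (by linear_combination -ha - hb + 2 * hcc) hc0
    apply hv0
    rw [this] at ha
    linarith

/-- The unique cubic-triangular number is `1`: if `n` and `m` are positive integers with
`n * (n + 1) / 2 = m ^ 3`, then `n = 1` and `m = 1`. -/
theorem unique_cubic_triangular (n m : ℕ) (hn : 0 < n) (hm : 0 < m)
    (h : n * (n + 1) = 2 * m ^ 3) : n = 1 ∧ m = 1 := by
  have hz : (n : ℤ) * (n + 1) = 2 * (m : ℤ) ^ 3 := by exact_mod_cast h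
  rcases Nat.even_or_odd' n with ⟨k, rfl | rfl⟩
  · exfalso
    push_cast at hz
    obtain ⟨a, b, ha, hb⟩ := ct_split (k : ℤ) (2 * k + 1) m ⟨-2, 1, by ring⟩ (by linarith)
    have ha0 : a ≠ 0 := by rintro rfl; simp at ha; omega
    have := ct_main _ b (-1) a rfl (isCoprime_one_right.neg_right)
      (by linear_combination -hb + 2 * ha) ha0
    rw [this] at hb
    norm_num at hb
    omega
  · push_cast at hz
    obtain ⟨a, b, ha, hb⟩ := ct_split ((k : ℤ) + 1) (2 * k + 1) m ⟨2, -1, by ring⟩ (by linarith)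
    have ha0 : a ≠ 0 := by rintro rfl; simp at ha; omega
    have := ct_main _ b 1 a rfl isCoprime_one_right
      (by linear_combination -hb + 2 * ha) ha0
    rw [this] at hb
    have hk : k = 0 := by norm_num at hb; omega
    subst hk
    refine ⟨rfl, ?_⟩
    have : m ^ 3 = 1 := by omega
    simpa using this
end

section
/- If n and m are positive integers with n(n+1)/2 = m^3, then there exist positive integers x and y such that n = y^3, n + 1 = 2x^3 and m = x·y (using that n and n+1 are coprime). -/
/-- The ring of Eisenstein integers. -/
abbrev EisInt : Type := QuadraticAlgebra ℤ (-1) (-1)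

namespace EisInt

theorem norm_eq (z : EisInt) :
    QuadraticAlgebra.norm z = z.re ^ 2 - z.re * z.im + z.im ^ 2 := by
  rw [QuadraticAlgebra.norm_def]; ring

theorem norm_nonneg' (z : EisInt) : 0 ≤ QuadraticAlgebra.norm z := by
  rw [norm_eq]; nlinarith [sq_nonneg (z.re - z.im), sq_nonneg (z.re), sq_nonneg z.im]

theorem norm_pos' (z : EisInt) (hz : z ≠ 0) : 0 < QuadraticAlgebra.norm z := by
  rcases (norm_nonneg' z).lt_or_eq with h | h
  · exact h
  · exfalso
    apply hz
    rw [norm_eq] at h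
    have h1 : z.re = 0 := by
      have : z.re ^ 2 ≤ 0 := by
        nlinarith [sq_nonneg (z.re - z.im), sq_nonneg (z.re), sq_nonneg z.im]
      exact pow_eq_zero_iff (two_ne_zero) |>.1 (le_antisymm this (sq_nonneg _))
    have h2 : z.im = 0 := by
      have : z.im ^ 2 ≤ 0 := by
        nlinarith [sq_nonneg (z.re - z.im), sq_nonneg (z.re), sq_nonneg z.im]
      exact pow_eq_zero_iff (two_ne_zero) |>.1 (le_antisymm this (sq_nonneg _))
    ext
    · simpa using h1
    · simpa using h2

theorem near (A n : ℤ) (hn : 0 < n) : ∃ k, -n ≤ 2 * (A - n * k) ∧ 2 * (A - n * k) ≤ n := by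
  refine ⟨(2 * A + n) / (2 * n), ?_⟩
  have h1 := Int.emod_add_mul_ediv (2 * A + n) (2 * n)
  have h2 := Int.emod_nonneg (2 * A + n) (b := 2 * n) (by omega)
  have h3 := Int.emod_lt_of_pos (2 * A + n) (b := 2 * n) (by omega)
  constructor <;> nlinarith

theorem exists_quot (z w : EisInt) (hw : w ≠ 0) :
    ∃ q : EisInt, QuadraticAlgebra.norm (z - w * q) < QuadraticAlgebra.norm w := by
  have hn := norm_pos' w hw
  set n := QuadraticAlgebra.norm w with hnd
  obtain ⟨k, hk1, hk2⟩ := near (z * star w).re n hn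
  obtain ⟨l, hl1, hl2⟩ := near (z * star w).im n hn
  refine ⟨⟨k, l⟩, ?_⟩
  have key : n * QuadraticAlgebra.norm (z - w * ⟨k, l⟩) =
      ((z * star w).re - n * k) ^ 2 - ((z * star w).re - n * k) * ((z * star w).im - n * l)
        + ((z * star w).im - n * l) ^ 2 := by
    rw [hnd, norm_eq, norm_eq]
    simp
    ring
  set r := (z * star w).re - n * k
  set t := (z * star w).im - n * l
  have hr : r ^ 2 - r * t + t ^ 2 < n * n := by nlinarith [mul_nonneg (sub_nonneg.2 hk2) (sub_nonneg.2 hl2), mul_nonneg (sub_nonneg.2 hk1) (sub_nonneg.2 hl1), mul_nonneg (sub_nonneg.2 hk1) (sub_nonneg.2 hl2), mul_nonneg (sub_nonneg.2 hk2) (sub_nonneg.2 hl1), mul_nonneg (sub_nonneg.2 hk1) (sub_nonneg.2 hk2), mul_nonneg (sub_nonneg.2 hl1) (sub_nonneg.2 hl2)]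
  nlinarith

open Classical in
/-- Euclidean quotient. -/
noncomputable def quot (z w : EisInt) : EisInt :=
  if hw : w ≠ 0 then (exists_quot z w hw).choose else 0

noncomputable instance : EuclideanDomain EisInt :=
  { (inferInstance : CommRing EisInt), (inferInstance : Nontrivial EisInt) with
    quotient := quot
    quotient_zero := fun a => by simp [quot]
    remainder := fun a b => a - b * quot a b
    quotient_mul_add_remainder_eq := fun a b => by ring
    r := fun a b => (QuadraticAlgebra.norm a).natAbs < (QuadraticAlgebra.norm b).natAbs
    r_wellFounded := (measure fun a : EisInt => (QuadraticAlgebra.norm a).natAbs).wf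
    remainder_lt := fun a b hb => by
      have h := (exists_quot a b hb).choose_spec
      have h0 := norm_nonneg' (a - b * quot a b)
      have h1 : quot a b = (exists_quot a b hb).choose := by simp [quot, hb]
      rw [← h1] at h
      change (QuadraticAlgebra.norm (a - b * quot a b)).natAbs < _
      omega
    mul_left_not_lt := fun a b hb => by
      have h := norm_pos' b hb
      have h0 := norm_nonneg' a
      rw [not_lt, map_mul, Int.natAbs_mul]
      exact Nat.le_mul_of_pos_right _ (by omega) }

theorem cube_of_coprime (a b c : EisInt) (hab : IsCoprime a b) (h : a * b = c ^ 3) :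
    ∃ d u : EisInt, QuadraticAlgebra.norm u = 1 ∧ a = u * d ^ 3 := by
  obtain ⟨d, u, hu⟩ := exists_associated_pow_of_mul_eq_pow' hab h
  refine ⟨d, u, ?_, by rw [← hu, mul_comm]⟩
  have := QuadraticAlgebra.isUnit_iff_norm_isUnit.1 u.isUnit
  rcases Int.isUnit_iff.1 this with h | h
  · exact h
  · have := norm_nonneg' (u : EisInt); omega

theorem unit_cases (x y : ℤ) (h : x ^ 2 - x * y + y ^ 2 = 1) (hx : x % 2 = 1) (hy : y % 2 = 0) :
    y = 0 ∧ (x = 1 ∨ x = -1) := by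
  have h1 : x ≤ 1 := by nlinarith [sq_nonneg (x - 2 * y)]
  have h2 : -1 ≤ x := by nlinarith [sq_nonneg (x - 2 * y)]
  have h3 : y ≤ 1 := by nlinarith [sq_nonneg (y - 2 * x)]
  have h4 : -1 ≤ y := by nlinarith [sq_nonneg (y - 2 * x)]
  omega

/-- Parametrization of coprime solutions of `p ^ 2 + 3 * q ^ 2 = s ^ 3` with `s` odd. -/
theorem param (p q s : ℤ) (hpq : IsCoprime p q) (hs : IsCoprime 6 s)
    (h : p ^ 2 + 3 * q ^ 2 = s ^ 3) :
    ∃ x y : ℤ, 2 * p = (x + y) * (2 * x - y) * (x - 2 * y) ∧ 2 * q = 3 * x * y * (x - y) ∧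
      IsCoprime x y := by
  have hodd : (p + q) % 2 = 1 := by
    have h2 : s % 2 = 1 := by
      obtain ⟨a, b, hab⟩ := hs
      by_contra hcon
      obtain ⟨k, rfl⟩ : ∃ k, s = 2 * k := ⟨s / 2, by omega⟩
      have : 2 * (a * 3 + b * k) = 1 := by linarith
      omega
    have h3 : Odd (p ^ 2 + 3 * q ^ 2) := by rw [h]; exact (Int.odd_iff.2 h2).pow
    rw [← Int.odd_iff]
    have h4 : Odd (3 : ℤ) := by decide
    simp only [Int.odd_add, Int.odd_pow, Int.even_mul, Int.even_pow] at h3 ⊢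
    simp_all [← Int.not_odd_iff_even]
  have hα : (⟨p + q, 2 * q⟩ : EisInt) * ⟨p - q, -2 * q⟩ = (⟨s, 0⟩ : EisInt) ^ 3 := by
    rw [pow_three]
    ext
    · simp
      linear_combination h
    · simp
      ring
  have hcop : IsCoprime (⟨p + q, 2 * q⟩ : EisInt) ⟨p - q, -2 * q⟩ := by
    obtain ⟨a, b, hab⟩ := hpq
    obtain ⟨c, d, hcd⟩ := hs.pow_right (n := 3)
    -- `6 = 3 a (α + β) - b √-3 (α - β)`
    refine ⟨⟨c, 0⟩ * (⟨3 * a, 0⟩ - ⟨b, 0⟩ * ⟨1, 2⟩) + ⟨d, 0⟩ * ⟨p - q, -2 * q⟩,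
      ⟨c, 0⟩ * (⟨3 * a, 0⟩ + ⟨b, 0⟩ * ⟨1, 2⟩), ?_⟩
    rw [← h] at hcd
    ext
    · simp [QuadraticAlgebra.re_one]
      linear_combination hcd + 6 * c * hab
    · simp [QuadraticAlgebra.im_one]
      ring
  obtain ⟨d, u, hu, hd⟩ := cube_of_coprime _ _ _ hcop hα
  obtain ⟨x, y⟩ := d
  obtain ⟨e, f⟩ := u
  rw [norm_eq] at hu
  simp only at hu
  rw [QuadraticAlgebra.ext_iff] at hd
  have hc : (⟨x, y⟩ : EisInt) ^ 3 = ⟨x ^ 3 - 3 * x * y ^ 2 + y ^ 3, 3 * x * y * (x - y)⟩ := by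
    rw [pow_three]
    ext <;> simp <;> ring
  rw [hc] at hd
  simp only [QuadraticAlgebra.re_mul, QuadraticAlgebra.im_mul] at hd
  obtain ⟨k, hk⟩ : ∃ k, 3 * x * y * (x - y) = 2 * k := by
    have : Even (3 * x * y * (x - y)) := by
      simp only [Int.even_mul, Int.even_sub]; tauto
    obtain ⟨k, hk⟩ := this
    exact ⟨k, by omega⟩
  rw [hk] at hd
  set g := x ^ 3 - 3 * x * y ^ 2 + y ^ 3 with hg
  obtain ⟨hd1, hd2⟩ := hd
  have hdo1 : Odd (e * g) := by
    rw [Int.odd_iff]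
    have : p + q = e * g + 2 * (-(f * k)) := by linarith
    omega
  have hge := Int.odd_mul.1 hdo1
  have hfe : Even (f * g) := by
    rw [Int.even_iff]
    have : 2 * q = f * g + 2 * (e * k - f * k) := by linarith
    omega
  have hf : Even f := by
    rcases Int.even_mul.1 hfe with h | h
    · exact h
    · exact absurd hge.2 (Int.not_odd_iff_even.2 h)
  obtain ⟨hf0, he⟩ := unit_cases e f hu (Int.odd_iff.1 hge.1) (Int.even_iff.1 hf)
  subst hf0
  have main : ∀ x y : ℤ, p + q = x ^ 3 - 3 * x * y ^ 2 + y ^ 3 → 2 * q = 3 * x * y * (x - y) →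
      ∃ x y : ℤ, 2 * p = (x + y) * (2 * x - y) * (x - 2 * y) ∧ 2 * q = 3 * x * y * (x - y) ∧
      IsCoprime x y := by
    intro x y h1 h2
    have h3 : 2 * p = (x + y) * (2 * x - y) * (x - 2 * y) := by linear_combination 2 * h1 - h2
    refine ⟨x, y, h3, h2, ?_⟩
    obtain ⟨a, b, hab⟩ := hpq
    obtain ⟨m, hm⟩ : ∃ m, p + q = 2 * m + 1 := ⟨(p + q) / 2, by omega⟩
    -- `1 = (p + q) - 2 m (a p + b q)`
    refine ⟨x ^ 2 - 3 * y ^ 2 - m * (a * (2 * x ^ 2 - 3 * x * y - 3 * y ^ 2)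
        + b * (3 * y * (x - y))), y ^ 2 - m * (a * (2 * y ^ 2)), ?_⟩
    linear_combination -h1 + hm + m * a * h3 + m * b * h2 - 2 * m * hab
  rcases he with rfl | rfl
  · exact main x y (by linarith) (by linarith)
  · exact main (-x) (-y) (by rw [hd1, hg]; ring) (by linarith)


theorem coprime_six (n : ℤ) (h2 : n % 2 = 1) (h3 : n % 3 ≠ 0) : IsCoprime 6 n := by
  have h : n % 6 = 1 ∨ n % 6 = 5 := by omega
  rcases h with h | h
  · exact ⟨-(n / 6), 1, by omega⟩
  · exact ⟨n / 6 + 1, -1, by omega⟩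

theorem cube_inj {a b : ℤ} (h : a ^ 3 = b ^ 3) : a = b :=
  (Odd.strictMono_pow (by decide : Odd 3)).injective h

theorem natAbs_lt_of_cube {r s c : ℤ} (hr : r ≠ 0) (h : r ^ 3 * s ^ 3 = c ^ 3) (hs : 1 < s ^ 3) :
    r.natAbs < c.natAbs := by
  have hc : r * s = c := cube_inj (by rw [mul_pow, h])
  have hs2 : 1 < s := by
    by_contra hcon
    have : s ^ 3 ≤ 1 ^ 3 := (Odd.strictMono_pow (by decide : Odd 3)).monotone (by omega)
    omega
  rw [← hc, Int.natAbs_mul]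
  have h1 : 0 < r.natAbs := by omega
  have h2 : 1 < s.natAbs := by omega
  nlinarith

theorem three_prime : Prime (3 : ℤ) := Int.prime_three

/-- The descent step. -/
theorem descent_step (a b c : ℤ) (hab : IsCoprime a b) (ha : a % 2 = 1) (hb : b % 2 = 1)
    (hne : a ≠ b) (hc : c ≠ 0) (h : a ^ 3 + b ^ 3 = 2 * c ^ 3) :
    ∃ A B C r : ℤ, A + B + C = 0 ∧ IsCoprime A B ∧ A * B * C = 2 * r ^ 3 ∧ r ≠ 0 ∧
      (A - B) * (B - C) * (C - A) ≠ 0 ∧ r.natAbs < c.natAbs := by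
  obtain ⟨p, q, rfl, rfl⟩ : ∃ p q, a = p + q ∧ b = p - q :=
    ⟨(a + b) / 2, (a - b) / 2, by omega, by omega⟩
  have hq : q ≠ 0 := by rintro rfl; simp at hne
  have hpq : IsCoprime p q := by
    obtain ⟨u, v, huv⟩ := hab
    exact ⟨u + v, u - v, by linear_combination huv⟩
  have h1 : p * (p ^ 2 + 3 * q ^ 2) = c ^ 3 := by linarith
  have hp : p ≠ 0 := by
    rintro rfl
    apply hc
    simpa using h1.symm
  have hsq : ((p + q) ^ 2) % 2 = 1 := Int.odd_iff.1 ((Int.odd_iff.2 ha).pow)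
  have hpp : 0 < p ^ 2 := by positivity
  have hqq : 0 < q ^ 2 := by positivity
  by_cases h3 : (3 : ℤ) ∣ p
  · obtain ⟨p1, rfl⟩ := h3
    have h3c : (3 : ℤ) ∣ c :=
      three_prime.dvd_of_dvd_pow (n := 3) ⟨p1 * ((3 * p1) ^ 2 + 3 * q ^ 2), by rw [← h1]; ring⟩
    obtain ⟨c1, rfl⟩ := h3c
    have h2 : p1 * (3 * p1 ^ 2 + q ^ 2) = 3 * c1 ^ 3 := by linarith
    have h3q : ¬ (3 : ℤ) ∣ q := by
      rintro ⟨k, rfl⟩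
      obtain ⟨u, v, huv⟩ := hpq
      have : 3 * (u * p1 + v * k) = 1 := by linarith
      omega
    have h3p : (3 : ℤ) ∣ p1 := by
      have : (3 : ℤ) ∣ p1 * q ^ 2 := ⟨c1 ^ 3 - p1 ^ 3, by linarith⟩
      rcases three_prime.dvd_or_dvd this with h | h
      · exact h
      · exact absurd (three_prime.dvd_of_dvd_pow h) h3q
    obtain ⟨t, rfl⟩ := h3p
    have h4 : t * (q ^ 2 + 3 * (3 * t) ^ 2) = c1 ^ 3 := by linarith
    have hqt : IsCoprime q (3 * t) := (IsCoprime.of_mul_left_right hpq).symm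
    have htq : IsCoprime t (q ^ 2 + 3 * (3 * t) ^ 2) := by
      have : IsCoprime t (q ^ 2) := (IsCoprime.of_mul_right_right hqt).symm.pow_right
      have h5 := this.add_mul_left_right (27 * t)
      have e : q ^ 2 + 3 * (3 * t) ^ 2 = q ^ 2 + t * (27 * t) := by ring
      rw [e]; exact h5
    obtain ⟨⟨r, hr⟩, ⟨s, hs⟩⟩ := Int.eq_pow_of_mul_eq_pow_odd htq (by decide : Odd 3) h4
    have ht : t ≠ 0 := by rintro rfl; simp at hp
    have hr0 : r ≠ 0 := by rintro rfl; simp at hr; exact ht hr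
    have h6 : IsCoprime 6 s := by
      have : IsCoprime 6 (s ^ 3) := by
        rw [← hs]
        apply coprime_six
        · have e : (3 * (3 * t) + q) ^ 2 - (q ^ 2 + 3 * (3 * t) ^ 2) =
            2 * (27 * t ^ 2 + 9 * t * q) := by ring
          omega
        · intro hcon
          apply h3q
          apply three_prime.dvd_of_dvd_pow (n := 2)
          omega
      exact (IsCoprime.pow_right_iff (by norm_num)).1 this
    obtain ⟨x, y, hx1, hx2, hxy⟩ := param q (3 * t) s hqt h6 hs
    refine ⟨x, -y, y - x, r, by ring, hxy.neg_right, by rw [← hr]; linarith, hr0, ?_, ?_⟩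
    · have : (x - -y) * (-y - (y - x)) * (y - x - x) = -2 * q := by linear_combination hx1
      rw [this]; omega
    · have h5 := natAbs_lt_of_cube (r := r) (s := s) (c := c1) hr0
        (by rw [← hr, ← hs, h4]) (by rw [← hs]; nlinarith [sq_nonneg t])
      omega
  · have hp3 : IsCoprime p 3 := ((Prime.coprime_iff_not_dvd three_prime).2 h3).symm
    have htq : IsCoprime p (p ^ 2 + 3 * q ^ 2) := by
      have : IsCoprime p (3 * q ^ 2) := hp3.mul_right hpq.pow_right
      have h5 := this.add_mul_left_right p
      have e : p ^ 2 + 3 * q ^ 2 = 3 * q ^ 2 + p * p := by ring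
      rw [e]; exact h5
    obtain ⟨⟨r, hr⟩, ⟨s, hs⟩⟩ := Int.eq_pow_of_mul_eq_pow_odd htq (by decide : Odd 3) h1
    have hr0 : r ≠ 0 := by rintro rfl; simp at hr; exact hp hr
    have h6 : IsCoprime 6 s := by
      have : IsCoprime 6 (s ^ 3) := by
        rw [← hs]
        apply coprime_six
        · have e : (p + q) ^ 2 - (p ^ 2 + 3 * q ^ 2) = 2 * (p * q - q ^ 2) := by ring
          omega
        · intro hcon
          apply h3
          apply three_prime.dvd_of_dvd_pow (n := 2)
          omega
      exact (IsCoprime.pow_right_iff (by norm_num)).1 this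
    obtain ⟨x, y, hx1, hx2, hxy⟩ := param p q s hpq h6 hs
    have hA : ¬ (3 : ℤ) ∣ x + y := by
      rintro ⟨k, hk⟩
      have : 2 * p = 3 * (k * (2 * x - y) * (x - 2 * y)) := by rw [hx1, hk]; ring
      omega
    have hA3 : IsCoprime (x + y) 3 := ((Prime.coprime_iff_not_dvd three_prime).2 hA).symm
    refine ⟨x + y, x - 2 * y, -(2 * x - y), -r, by ring, ?_, ?_, by simpa using hr0, ?_, ?_⟩
    · obtain ⟨u, v, huv⟩ := hxy
      obtain ⟨e, f, hef⟩ := hA3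
      exact ⟨e + f * (2 * u + v), f * (u - v), by linear_combination hef + 3 * f * huv⟩
    · have : (-r) ^ 3 = -p := by rw [hr]; ring
      rw [this]; linear_combination hx1
    · have : (x + y - (x - 2 * y)) * (x - 2 * y - -(2 * x - y)) * (-(2 * x - y) - (x + y)) =
        -18 * q := by linear_combination 9 * hx2
      rw [this]; omega
    · rw [Int.natAbs_neg]
      exact natAbs_lt_of_cube (s := s) hr0 (by rw [← hr, ← hs, h1]) (by rw [← hs]; linarith)

theorem main_aux (n : ℕ) : ∀ A B C r : ℤ, r.natAbs = n → A + B + C = 0 → IsCoprime A B →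
    A * B * C = 2 * r ^ 3 → r ≠ 0 → (A - B) * (B - C) * (C - A) = 0 := by
  induction n using Nat.strong_induction_on with
  | _ n ih =>
  have key : ∀ A B C r : ℤ, C % 2 = 0 → r.natAbs = n → A + B + C = 0 → IsCoprime A B →
      A * B * C = 2 * r ^ 3 → r ≠ 0 → (A - B) * (B - C) * (C - A) = 0 := by
    intro A B C r hC hrn hsum hAB hprod hr
    obtain ⟨D, rfl⟩ : ∃ D, C = 2 * D := ⟨C / 2, by omega⟩
    have hA2 : A % 2 = 1 := by
      by_contra hcon
      obtain ⟨u, v, huv⟩ := hAB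
      obtain ⟨k, rfl⟩ : ∃ k, A = 2 * k := ⟨A / 2, by omega⟩
      obtain ⟨l, rfl⟩ : ∃ k, B = 2 * k := ⟨B / 2, by omega⟩
      have : 2 * (u * k + v * l) = 1 := by linarith
      omega
    have hB2 : B % 2 = 1 := by omega
    have hp : (A * B) * D = r ^ 3 := by linarith
    have hABD : IsCoprime (A * B) D := by
      apply IsCoprime.of_mul_right_right (y := 2)
      obtain ⟨u, v, huv⟩ := hAB
      have e : 2 * D = -A - B := by omega
      rw [e]
      apply IsCoprime.mul_left
      · exact ⟨u - v, -v, by linear_combination huv⟩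
      · exact ⟨v - u, -u, by linear_combination huv⟩
    obtain ⟨⟨e, he⟩, ⟨c, hc⟩⟩ := Int.eq_pow_of_mul_eq_pow_odd hABD (by decide : Odd 3) hp
    obtain ⟨⟨a, ha⟩, ⟨b, hb⟩⟩ := Int.eq_pow_of_mul_eq_pow_odd hAB (by decide : Odd 3) he
    by_cases hab : a = b
    · rw [ha, hb, hab]; ring
    have hecr : e * c = r := cube_inj (by rw [mul_pow, ← he, ← hc, hp])
    have hc0 : c ≠ 0 := by rintro rfl; simp at hecr; exact hr hecr.symm
    have he0 : e ≠ 0 := by rintro rfl; simp at hecr; exact hr hecr.symm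
    have ho : ∀ z Z : ℤ, Z = z ^ 3 → Z % 2 = 1 → z % 2 = 1 := by
      intro z Z h1 h2
      rw [← Int.odd_iff] at h2 ⊢
      rw [h1] at h2
      exact (Int.odd_pow.1 h2).resolve_right (by norm_num)
    obtain ⟨A', B', C', r', h1, h2, h3, h4, h5, h6⟩ := descent_step a b (-c)
      (by
        rw [ha, hb] at hAB
        exact (IsCoprime.pow_iff (by norm_num) (by norm_num)).1 hAB)
      (ho a A ha hA2) (ho b B hb hB2) hab (by simpa using hc0)
      (by rw [← ha, ← hb]; have : (-c) ^ 3 = -D := by rw [hc]; ring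
          rw [this]; linarith)
    refine absurd (ih r'.natAbs ?_ A' B' C' r' rfl h1 h2 h3 h4) h5
    rw [Int.natAbs_neg] at h6
    rw [← hrn, ← hecr, Int.natAbs_mul]
    exact lt_of_lt_of_le h6 (Nat.le_mul_of_pos_left _ (by omega))
  intro A B C r hrn hsum hAB hprod hr
  have hBC : IsCoprime B C := by
    obtain ⟨u, v, huv⟩ := hAB
    obtain rfl : C = -A - B := by omega
    exact ⟨v - u, -u, by linear_combination huv⟩
  have hCA : IsCoprime C A := by
    obtain ⟨u, v, huv⟩ := hAB
    obtain rfl : C = -A - B := by omega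
    exact ⟨-v, u - v, by linear_combination huv⟩
  have hcases : C % 2 = 0 ∨ A % 2 = 0 ∨ B % 2 = 0 := by omega
  rcases hcases with h | h | h
  · exact key A B C r h hrn hsum hAB hprod hr
  · rw [← key B C A r h hrn (by omega) hBC (by linarith) hr]; ring
  · rw [← key C A B r h hrn (by omega) hCA (by linarith) hr]; ring

end EisInt

/-- If `n` and `m` are positive integers with `n * (n + 1) / 2 = m ^ 3`, then there exist
positive integers `x` and `y` with `n = y ^ 3`, `n + 1 = 2 * x ^ 3` and `m = x * y`. -/
theorem cubic_triangular_decomposition (n m : ℕ) (hn : 0 < n) (hm : 0 < m)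
    (h : n * (n + 1) = 2 * m ^ 3) :
    ∃ x y : ℕ, 0 < x ∧ 0 < y ∧ n = y ^ 3 ∧ n + 1 = 2 * x ^ 3 ∧ m = x * y := by
  have hz : (n : ℤ) * (n + 1) = 2 * (m : ℤ) ^ 3 := by exact_mod_cast h
  have key := EisInt.main_aux _ (n : ℤ) 1 (-n - 1) (-m) rfl (by ring) isCoprime_one_right
    (by linear_combination -hz) (by omega)
  have hn1 : n = 1 := by
    rcases mul_eq_zero.1 key with h1 | h1
    · rcases mul_eq_zero.1 h1 with h2 | h2 <;> omega
    · omega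
  subst hn1
  have hm1 : m = 1 := by
    have : m ^ 3 = 1 := by omega
    exact (Nat.pow_eq_one.1 this).resolve_right (by norm_num)
  subst hm1
  exact ⟨1, 1, by norm_num⟩
end
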